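/- arXiv:1704.07629 — 5 statements merged into one kernel-verified Lean document; each statement's English description precedes it below -/
import Mathlib

section
/- [Proposition 3.1, case 2] Suppose r̃_M < min(r_R, r_B) and set Q̃₁ = (g_AR·P_A − g_RM·P_R)·σ²/(g_MR·g_RM·P_R). If Q̃₁ ≤ Q_max, then 0 < Q̃₁, R̃(Q̃₁) = r̃_M, and R̃(Q₁) ≤ r̃_M for every Q₁ ∈ [0, Q_max]; consequently r̃_M is the greatest value of R̃ over [0, Q_max], i.e., the maximum eavesdropping rate is R_eav^(II) = r̃_M, attained at Q₁⋆ = Q̃₁. -/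
/-- Proposition 3.1, case 2: if r̃_M < min(r_R, r_B) and Q̃₁ ≤ Q_max, then the
maximum eavesdropping rate over [0, Q_max] is r̃_M, attained at Q̃₁. -/
theorem stmt_4
    (P_A P_R Q_max σ2 g_AR g_RB g_MR g_RM : ℝ)
    (hPA : 0 < P_A) (hPR : 0 < P_R) (hQmax : 0 < Q_max) (hσ2 : 0 < σ2)
    (hgAR : 0 < g_AR) (hgRB : 0 < g_RB) (hgMR : 0 < g_MR) (hgRM : 0 < g_RM)
    (rR rB rM : ℝ) (rRt : ℝ → ℝ) (Rt : ℝ → ℝ)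
    (hrR : rR = (1/2) * Real.logb 2 (1 + g_AR * P_A / σ2))
    (hrB : rB = (1/2) * Real.logb 2 (1 + g_RB * P_R / σ2))
    (hrRt : ∀ Q1, rRt Q1 = (1/2) * Real.logb 2 (1 + g_AR * P_A / (g_MR * Q1 + σ2)))
    (hrM : rM = (1/2) * Real.logb 2 (1 + g_RM * P_R / σ2))
    (hRt : ∀ Q1, Rt Q1 = if min (rRt Q1) rB ≤ rM then min (rRt Q1) rB else 0)
    (hcase : rM < min rR rB)
    (Qt1 : ℝ)
    (hQt1 : Qt1 = (g_AR * P_A - g_RM * P_R) * σ2 / (g_MR * g_RM * P_R))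
    (hfeas : Qt1 ≤ Q_max) :
    0 < Qt1 ∧ Rt Qt1 = rM ∧ (∀ Q1 ∈ Set.Icc 0 Q_max, Rt Q1 ≤ rM) ∧
      IsGreatest (Rt '' Set.Icc 0 Q_max) rM := by
  have hAR : 0 < g_AR * P_A := mul_pos hgAR hPA
  have hRM : 0 < g_RM * P_R := mul_pos hgRM hPR
  have hrM_nonneg : 0 ≤ rM := by
    rw [hrM]
    have : 0 ≤ Real.logb 2 (1 + g_RM * P_R / σ2) :=
      Real.logb_nonneg one_lt_two (le_add_of_nonneg_right (div_pos hRM hσ2).le)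
    positivity
  have hgain : g_RM * P_R < g_AR * P_A := by
    have h := hcase.trans_le (min_le_left _ _)
    rw [hrM, hrR] at h
    have h' := lt_of_mul_lt_mul_left h (by norm_num)
    rw [Real.logb_lt_logb_iff one_lt_two (by positivity) (by positivity)] at h'
    exact (div_lt_div_iff_of_pos_right hσ2).mp (lt_of_add_lt_add_left h')
  have hpos : 0 < Qt1 := by
    rw [hQt1]
    exact div_pos (mul_pos (sub_pos.mpr hgain) hσ2) (by positivity)
  have hrate : rRt Qt1 = rM := by
    have hnoise : g_MR * Qt1 + σ2 = g_AR * P_A * σ2 / (g_RM * P_R) := by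
      rw [hQt1]
      field_simp
      ring
    have hsnr : g_AR * P_A / (g_MR * Qt1 + σ2) = g_RM * P_R / σ2 := by
      rw [hnoise]
      field_simp
    rw [hrRt, hsnr, hrM]
  have hattain : Rt Qt1 = rM := by
    rw [hRt, hrate, min_eq_left (hcase.trans_le (min_le_right _ _)).le, if_pos le_rfl]
  have hbound : ∀ Q1, Rt Q1 ≤ rM := by
    intro Q1
    rw [hRt]
    split_ifs with h
    exacts [h, hrM_nonneg]
  exact ⟨hpos, hattain, fun Q1 _ => hbound Q1, ⟨Qt1, ⟨hpos.le, hfeas⟩, hattain⟩,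
    Set.forall_mem_image.mpr fun Q1 _ => hbound Q1⟩
end

section
/- [Proposition 3.1, case 3] Suppose r̃_M < min(r_R, r_B) and Q̃₁ = (g_AR·P_A − g_RM·P_R)·σ²/(g_MR·g_RM·P_R) > Q_max. Then R̃(Q₁) = 0 for every Q₁ ∈ [0, Q_max]; that is, eavesdropping is unsuccessful for every feasible noise-jamming power. -/
/-- Proposition 3.1, case 3: if r̃_M < min(r_R, r_B) and Q̃₁ > Q_max, then
eavesdropping is unsuccessful for every feasible noise-jamming power. -/
theorem stmt_5
    (P_A P_R Q_max σ2 g_AR g_RB g_MR g_RM : ℝ)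
    (hPA : 0 < P_A) (hPR : 0 < P_R) (hQmax : 0 < Q_max) (hσ2 : 0 < σ2)
    (hgAR : 0 < g_AR) (hgRB : 0 < g_RB) (hgMR : 0 < g_MR) (hgRM : 0 < g_RM)
    (rR rB rM : ℝ) (rRt : ℝ → ℝ) (Rt : ℝ → ℝ)
    (hrR : rR = (1/2) * Real.logb 2 (1 + g_AR * P_A / σ2))
    (hrB : rB = (1/2) * Real.logb 2 (1 + g_RB * P_R / σ2))
    (hrRt : ∀ Q1, rRt Q1 = (1/2) * Real.logb 2 (1 + g_AR * P_A / (g_MR * Q1 + σ2)))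
    (hrM : rM = (1/2) * Real.logb 2 (1 + g_RM * P_R / σ2))
    (hRt : ∀ Q1, Rt Q1 = if min (rRt Q1) rB ≤ rM then min (rRt Q1) rB else 0)
    (hcase : rM < min rR rB)
    (Qt1 : ℝ)
    (hQt1 : Qt1 = (g_AR * P_A - g_RM * P_R) * σ2 / (g_MR * g_RM * P_R))
    (hinfeas : Q_max < Qt1) :
    ∀ Q1 ∈ Set.Icc 0 Q_max, Rt Q1 = 0 := by
  rintro Q1 ⟨hQ0, hQ1⟩
  have hlt : Q1 < Qt1 := hQ1.trans_lt hinfeas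
  rw [hQt1, lt_div_iff₀ (by positivity)] at hlt
  have hSNR : g_RM * P_R / σ2 < g_AR * P_A / (g_MR * Q1 + σ2) := by
    rw [div_lt_div_iff₀ hσ2 (by positivity)]
    linarith
  have hrate : rM < rRt Q1 := by
    rw [hrM, hrRt]
    have := Real.logb_lt_logb one_lt_two
      (show 0 < 1 + g_RM * P_R / σ2 by positivity) (add_lt_add_right hSNR 1)
    linarith
  rw [hRt, if_neg (not_le.mpr (lt_min hrate (hcase.trans_le (min_le_right _ _))))]
end

section
/- [Lemma 1, boundary case] If a > b·L and a·b·L ≤ σ² + Q_max·g_MB, then the point (L, 0) belongs to S and γ̂_B(L, 0) ≤ γ̂_B(α, Q₂) for every (α, Q₂) ∈ S; that is, Bob's SINR over the feasible set is minimized by amplifying at the largest feasible coefficient L with no artificial noise. -/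
/-- The map `x ↦ (a - x)² / (D - x²)` is antitone on `x ≤ y` as long as `y ≤ a` and `a * y ≤ D`,
stated in cross-multiplied form. -/
theorem sq_sub_mul_sub_sq_le {a x y D : ℝ} (ha : 0 ≤ a) (hxy : x ≤ y) (hya : y ≤ a)
    (hD : a * y ≤ D) : (a - y) ^ 2 * (D - x ^ 2) ≤ (a - x) ^ 2 * (D - y ^ 2) := by
  have h1 : 0 ≤ (D - a * y) * (2 * a - x - y) :=
    mul_nonneg (by linarith) (by linarith)
  have h2 : 0 ≤ a * ((y - x) * (a - y)) :=
    mul_nonneg ha (mul_nonneg (by linarith) (by linarith))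
  have h3 := mul_nonneg (sub_nonneg.2 hxy) (add_nonneg h1 h2)
  linear_combination h3

/-- Lemma 1, boundary case: if a > b·L and a·b·L ≤ σ² + Q_max·g_MB, Bob's
SINR over the feasible set is minimized at (L, 0). -/
theorem stmt_11
    (P_A P_R Q_max σ2 g_AR g_RB g_AM g_MB : ℝ)
    (hPA : 0 < P_A) (hPR : 0 < P_R) (hQmax : 0 < Q_max) (hσ2 : 0 < σ2)
    (hgAR : 0 < g_AR) (hgRB : 0 < g_RB) (hgAM : 0 < g_AM) (hgMB : 0 < g_MB)
    (a b L : ℝ)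
    (ha : a = Real.sqrt (P_R * g_RB)) (hb : b = Real.sqrt (P_A * g_AM * g_MB))
    (hL : L = Real.sqrt (Q_max / (P_A * g_AM + σ2)))
    (γB : ℝ → ℝ → ℝ)
    (hγB : ∀ α Q2, γB α Q2 = (a - b * α)^2 / (g_MB * Q2 + α^2 * g_MB * σ2 + σ2))
    (S : Set (ℝ × ℝ))
    (hS : S = {p : ℝ × ℝ | 0 ≤ p.1 ∧ 0 ≤ p.2 ∧
      p.1^2 * (P_A * g_AM + σ2) + p.2 ≤ Q_max})
    (hcase1 : b * L < a) (hcase2 : a * b * L ≤ σ2 + Q_max * g_MB) :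
    (L, (0:ℝ)) ∈ S ∧ ∀ α Q2 : ℝ, (α, Q2) ∈ S → γB L 0 ≤ γB α Q2 := by
  have hK : 0 < P_A * g_AM + σ2 := by positivity
  have ha0 : 0 ≤ a := ha ▸ Real.sqrt_nonneg _
  have hb0 : 0 ≤ b := hb ▸ Real.sqrt_nonneg _
  have hL0 : 0 ≤ L := hL ▸ Real.sqrt_nonneg _
  have hb2 : b ^ 2 = P_A * g_AM * g_MB := by rw [hb, Real.sq_sqrt (by positivity)]
  have hL2 : L ^ 2 * (P_A * g_AM + σ2) = Q_max := by
    rw [hL, Real.sq_sqrt (by positivity), div_mul_cancel₀ _ hK.ne']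
  subst hS
  refine ⟨⟨hL0, le_rfl, by simp [hL2]⟩, ?_⟩
  rintro α Q2 ⟨hα, hQ2, hle⟩
  simp only at hα hQ2 hle
  have hαL : α ≤ L := by
    refine (sq_le_sq₀ hα hL0).1 ?_
    refine le_of_mul_le_mul_right ?_ hK
    linarith
  have key := sq_sub_mul_sub_sq_le ha0 (mul_le_mul_of_nonneg_left hαL hb0) hcase1.le
    (by linarith : a * (b * L) ≤ σ2 + Q_max * g_MB)
  have hdenL : σ2 + Q_max * g_MB - (b * L) ^ 2 = g_MB * 0 + L ^ 2 * g_MB * σ2 + σ2 := by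
    rw [mul_pow, hb2, ← hL2]; ring
  have hden : g_MB * Q2 + α ^ 2 * g_MB * σ2 + σ2 ≤ σ2 + Q_max * g_MB - (b * α) ^ 2 := by
    rw [mul_pow, hb2]
    linear_combination g_MB * hle
  rw [hγB, hγB, div_le_div_iff₀ (by positivity) (by positivity), ← hdenL]
  exact (mul_le_mul_of_nonneg_left hden (sq_nonneg _)).trans key
end

section
/- [Proposition 3.2, case 1] Assume b·L ≤ 2·a. If r̂_M ≥ min(r_R, r_B), then R̂(0, 0) = min(r_R, r_B) and R̂(α, Q₂) ≤ min(r_R, r_B) for every (α, Q₂) ∈ S; consequently (α⋆, Q₂⋆) = (0, 0) maximizes the mode-III eavesdropping rate over S, with maximum value R_eav^(III) = min(r_R, r_B). -/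
/-- If the effective amplitude `b * x` is at most `2 * a`, then interference cancellation and
additional noise can only lower the signal-to-noise ratio. -/
theorem sq_sub_mul_div_le_sq_div {a b x L s d : ℝ} (hb : 0 ≤ b) (hx : 0 ≤ x) (hxL : x ≤ L)
    (hbL : b * L ≤ 2 * a) (hs : 0 < s) (hsd : s ≤ d) :
    (a - b * x) ^ 2 / d ≤ a ^ 2 / s := by
  have hbx : 0 ≤ b * x := mul_nonneg hb hx
  have hbx' : b * x ≤ 2 * a := (mul_le_mul_of_nonneg_left hxL hb).trans hbL
  refine div_le_div₀ (sq_nonneg a) ?_ hs hsd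
  nlinarith [mul_nonneg hbx (sub_nonneg.2 hbx')]


/-- Proposition 3.2, case 1: if r̂_M ≥ min(r_R, r_B), passive operation
(α, Q₂) = (0, 0) maximizes the mode-III eavesdropping rate over the
feasible set, with maximum value min(r_R, r_B). -/
theorem stmt_15
    (P_A P_R Q_max σ2 g_AR g_RB g_AM g_MB : ℝ)
    (hPA : 0 < P_A) (hPR : 0 < P_R) (hQmax : 0 < Q_max) (hσ2 : 0 < σ2)
    (hgAR : 0 < g_AR) (hgRB : 0 < g_RB) (hgAM : 0 < g_AM) (hgMB : 0 < g_MB)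
    (a b L : ℝ)
    (ha : a = Real.sqrt (P_R * g_RB)) (hb : b = Real.sqrt (P_A * g_AM * g_MB))
    (hL : L = Real.sqrt (Q_max / (P_A * g_AM + σ2)))
    (γB rB' : ℝ → ℝ → ℝ) (rR rB rM : ℝ) (Rh : ℝ → ℝ → ℝ)
    (hγB : ∀ α Q2, γB α Q2 = (a - b * α)^2 / (g_MB * Q2 + α^2 * g_MB * σ2 + σ2))
    (hrB' : ∀ α Q2, rB' α Q2 = (1/2) * Real.logb 2 (1 + γB α Q2))
    (hrR : rR = (1/2) * Real.logb 2 (1 + g_AR * P_A / σ2))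
    (hrB : rB = (1/2) * Real.logb 2 (1 + g_RB * P_R / σ2))
    (hrM : rM = (1/2) * Real.logb 2 (1 + g_AM * P_A / σ2))
    (hRh : ∀ α Q2, Rh α Q2 =
      if min rR (rB' α Q2) ≤ rM then min rR (rB' α Q2) else 0)
    (S : Set (ℝ × ℝ))
    (hS : S = {p : ℝ × ℝ | 0 ≤ p.1 ∧ 0 ≤ p.2 ∧
      p.1^2 * (P_A * g_AM + σ2) + p.2 ≤ Q_max})
    (hbL : b * L ≤ 2 * a)
    (hcase : rM ≥ min rR rB) :
    ((0:ℝ), (0:ℝ)) ∈ S ∧ Rh 0 0 = min rR rB ∧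
      ∀ α Q2 : ℝ, (α, Q2) ∈ S → Rh α Q2 ≤ min rR rB := by
  have hb0 : 0 ≤ b := hb ▸ Real.sqrt_nonneg _
  have ha2 : a ^ 2 = g_RB * P_R := by
    rw [ha, Real.sq_sqrt (by positivity), mul_comm]
  have hzero : rB' 0 0 = rB := by
    simp [hrB', hγB, hrB, ha2]
  have hrR0 : 0 ≤ rR := by
    rw [hrR]
    exact mul_nonneg (by norm_num)
      (Real.logb_nonneg one_lt_two (le_add_of_nonneg_right (by positivity)))
  have hrB0 : 0 ≤ rB := by
    rw [hrB]
    exact mul_nonneg (by norm_num)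
      (Real.logb_nonneg one_lt_two (le_add_of_nonneg_right (by positivity)))
  refine ⟨?_, ?_, fun α Q2 hmem => ?_⟩
  · rw [hS]
    simpa using hQmax.le
  · rw [hRh, hzero, if_pos hcase]
  · rw [hS] at hmem
    obtain ⟨hα, hQ2, hpow⟩ : 0 ≤ α ∧ 0 ≤ Q2 ∧ α ^ 2 * (P_A * g_AM + σ2) + Q2 ≤ Q_max := hmem
    have hαL : α ≤ L := by
      rw [hL]
      refine Real.le_sqrt_of_sq_le ((le_div_iff₀ (by positivity)).2 ?_)
      linarith
    have hden : σ2 ≤ g_MB * Q2 + α ^ 2 * g_MB * σ2 + σ2 :=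
      le_add_of_nonneg_left (by positivity)
    have hrate : rB' α Q2 ≤ rB := by
      have hsnr := sq_sub_mul_div_le_sq_div hb0 hα hαL hbL hσ2 hden
      rw [ha2] at hsnr
      rw [hrB', hγB, hrB]
      have hnum : 0 ≤ (a - b * α) ^ 2 / (g_MB * Q2 + α ^ 2 * g_MB * σ2 + σ2) :=
        div_nonneg (sq_nonneg _) (hσ2.le.trans hden)
      exact mul_le_mul_of_nonneg_left
        (Real.logb_le_logb_of_le one_lt_two (by linarith) (by linarith)) (by norm_num)
    rw [hRh]
    split_ifs
    · exact min_le_min_left _ hrate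
    · exact le_min hrR0 hrB0
end

section
/- [Proposition 3.2, case 2] Suppose r̂_M < min(r_R, r_B) and there exists (α₀, Q₀) ∈ S with r̂_B(α₀, Q₀) ≤ r̂_M. Then there exists (α⋆, Q₂⋆) ∈ S with R̂(α⋆, Q₂⋆) = r̂_M, and R̂(α, Q₂) ≤ r̂_M for every (α, Q₂) ∈ S; consequently r̂_M is the greatest value of the mode-III eavesdropping rate over S, i.e., R_eav^(III) = r̂_M. -/
/-- Proposition 3.2, case 2: if r̂_M < min(r_R, r_B) and successful hybrid
jamming is feasible, then r̂_M is the greatest value of the mode-III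
eavesdropping rate over the feasible set. -/
theorem stmt_17
    (P_A P_R Q_max σ2 g_AR g_RB g_AM g_MB : ℝ)
    (hPA : 0 < P_A) (hPR : 0 < P_R) (hQmax : 0 < Q_max) (hσ2 : 0 < σ2)
    (hgAR : 0 < g_AR) (hgRB : 0 < g_RB) (hgAM : 0 < g_AM) (hgMB : 0 < g_MB)
    (a b : ℝ)
    (ha : a = Real.sqrt (P_R * g_RB)) (hb : b = Real.sqrt (P_A * g_AM * g_MB))
    (γB rB' : ℝ → ℝ → ℝ) (rR rB rM : ℝ) (Rh : ℝ → ℝ → ℝ)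
    (hγB : ∀ α Q2, γB α Q2 = (a - b * α)^2 / (g_MB * Q2 + α^2 * g_MB * σ2 + σ2))
    (hrB' : ∀ α Q2, rB' α Q2 = (1/2) * Real.logb 2 (1 + γB α Q2))
    (hrR : rR = (1/2) * Real.logb 2 (1 + g_AR * P_A / σ2))
    (hrB : rB = (1/2) * Real.logb 2 (1 + g_RB * P_R / σ2))
    (hrM : rM = (1/2) * Real.logb 2 (1 + g_AM * P_A / σ2))
    (hRh : ∀ α Q2, Rh α Q2 =
      if min rR (rB' α Q2) ≤ rM then min rR (rB' α Q2) else 0)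
    (S : Set (ℝ × ℝ))
    (hS : S = {p : ℝ × ℝ | 0 ≤ p.1 ∧ 0 ≤ p.2 ∧
      p.1^2 * (P_A * g_AM + σ2) + p.2 ≤ Q_max})
    (hcase : rM < min rR rB)
    (α₀ Q₀ : ℝ) (hmem : (α₀, Q₀) ∈ S) (hlow : rB' α₀ Q₀ ≤ rM) :
    (∃ αs Qs : ℝ, (αs, Qs) ∈ S ∧ Rh αs Qs = rM) ∧
      (∀ α Q2 : ℝ, (α, Q2) ∈ S → Rh α Q2 ≤ rM) ∧
      IsGreatest {r : ℝ | ∃ α Q2 : ℝ, (α, Q2) ∈ S ∧ r = Rh α Q2} rM := by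
  have hrM0 : 0 ≤ rM := by
    have hlog : 0 ≤ Real.logb 2 (1 + g_AM * P_A / σ2) :=
      Real.logb_nonneg one_lt_two (le_add_of_nonneg_right (by positivity))
    rw [hrM]
    positivity
  have hle : ∀ α Q2 : ℝ, Rh α Q2 ≤ rM := by
    intro α Q2
    rw [hRh]
    split_ifs with h
    exacts [h, hrM0]
  have hmem' := hmem
  rw [hS] at hmem'
  obtain ⟨hα, hQ, hbudget⟩ := hmem'
  simp only at hα hQ hbudget
  have hcont : ContinuousOn (fun t : ℝ => rB' (t * α₀) (t * Q₀)) (Set.Icc 0 1) := by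
    intro t ht
    have ht0 := ht.1
    have hden : 0 < g_MB * (t * Q₀) + (t * α₀) ^ 2 * g_MB * σ2 + σ2 := by positivity
    have harg : 1 + (a - b * (t * α₀)) ^ 2 /
        (g_MB * (t * Q₀) + (t * α₀) ^ 2 * g_MB * σ2 + σ2) ≠ 0 := by positivity
    simp only [hrB', hγB, Real.logb]
    refine ContinuousAt.continuousWithinAt ?_
    refine continuousAt_const.mul (ContinuousAt.div_const ?_ _)
    refine ContinuousAt.log ?_ harg
    exact continuousAt_const.add (ContinuousAt.div (by fun_prop) (by fun_prop) hden.ne')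
  have hzero : rB' (0 * α₀) (0 * Q₀) = rB := by
    have ha2 : a ^ 2 = g_RB * P_R := by
      rw [ha, Real.sq_sqrt (by positivity), mul_comm]
    simp [hrB', hγB, hrB, ha2]
  have hattained : ∃ αs Qs : ℝ, (αs, Qs) ∈ S ∧ Rh αs Qs = rM := by
    obtain ⟨t, ⟨ht0, ht1⟩, ht⟩ := intermediate_value_Icc' zero_le_one hcont
      (show rM ∈ Set.Icc _ _ by
        refine ⟨by simpa using hlow, ?_⟩
        simp only [hzero]
        exact (hcase.trans_le (min_le_right _ _)).le)
    refine ⟨t * α₀, t * Q₀, ?_, ?_⟩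
    · rw [hS]
      refine ⟨by positivity, by positivity, le_trans ?_ hbudget⟩
      have hαt : t * α₀ ≤ α₀ := mul_le_of_le_one_left hα ht1
      have hQt : t * Q₀ ≤ Q₀ := mul_le_of_le_one_left hQ ht1
      dsimp only
      gcongr
    · have hmin : min rR (rB' (t * α₀) (t * Q₀)) = rM := by
        simp only at ht
        rw [ht]
        exact min_eq_right (hcase.trans_le (min_le_left _ _)).le
      rw [hRh, hmin, if_pos le_rfl]
  refine ⟨hattained, fun α Q2 _ => hle α Q2, ?_, ?_⟩
  · obtain ⟨αs, Qs, hs, heq⟩ := hattained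
    exact ⟨αs, Qs, hs, heq.symm⟩
  · rintro r ⟨α, Q2, _, rfl⟩
    exact hle α Q2
end
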